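/- Let Ω = {(x₁,x₂,x₃) ∈ ℝ³ : x₁² + x₂² > 1}. There is a constant C > 0, independent of s, T, and u, with the following property: for all real numbers s < T and every smooth axisymmetric vector field u : Ω × [s,T] → ℝ³ such that there is a compact set K ⊂ Ω with u(·,t) supported in K for all t ∈ [s,T], one has ∫_s^T ‖u(·,t)‖_{L^∞(Ω)}² dt ≤ C ( ∫_s^T ∫_Ω |∇u|² dx dt ) · ln( e + ( ∫_s^T ( ‖u(·,t)‖_{L⁶(Ω)} + ‖∇u(·,t)‖_{L⁶(Ω)} )² dt )^{1/2} ) + C. -/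

import Mathlib

open MeasureTheory Set

noncomputable section

/-- Three-dimensional Euclidean space. -/
abbrev E3 := EuclideanSpace ℝ (Fin 3)

/-- The exterior of the unit cylinder in `ℝ³`. -/
def Ω : Set E3 := {x | 1 < x 0 ^ 2 + x 1 ^ 2}

/-- The point with cylindrical coordinates `(r, θ, z)`. -/
def cyl (r θ z : ℝ) : E3 :=
  (WithLp.equiv 2 (Fin 3 → ℝ)).symm ![r * Real.cos θ, r * Real.sin θ, z]

/-- Radial basis vector `e_r(θ)`. -/
def erv (θ : ℝ) : E3 :=
  (WithLp.equiv 2 (Fin 3 → ℝ)).symm ![Real.cos θ, Real.sin θ, 0]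

/-- Angular basis vector `e_θ(θ)`. -/
def eθv (θ : ℝ) : E3 :=
  (WithLp.equiv 2 (Fin 3 → ℝ)).symm ![-Real.sin θ, Real.cos θ, 0]

/-- Vertical basis vector `e_z`. -/
def ezv : E3 := (WithLp.equiv 2 (Fin 3 → ℝ)).symm ![0, 0, 1]

/-- Squared Frobenius norm of the (spatial) Jacobian matrix of a vector field. -/
def frobSq (u : E3 → E3) (x : E3) : ℝ :=
  ∑ i : Fin 3, ‖fderiv ℝ u x (EuclideanSpace.single i 1)‖ ^ 2


lemma mp_e3 : MeasurePreserving (fun p : ℝ × (ℝ × ℝ) =>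
    (WithLp.toLp 2 ![p.2.1, p.2.2, p.1] : E3)) := by
  have h1 := (volume_preserving_piFinSuccAbove (fun _ : Fin 3 => ℝ) 2).symm
  have h2 := (volume_preserving_finTwoArrow ℝ).symm
  have h3 := PiLp.volume_preserving_toLp (Fin 3)
  have h4 := (MeasurePreserving.id (volume : Measure ℝ)).prod h2
  have h5 := h3.comp (h1.comp h4)
  rw [← Measure.volume_eq_prod] at h5
  convert h5 using 1
  ext p i
  fin_cases i <;> simp [MeasurableEquiv.piFinSuccAbove, MeasurableEquiv.finTwoArrow, Fin.insertNthEquiv] <;> rfl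

lemma lintegral_cyl (F : E3 → ENNReal) (hF : Measurable F) :
    ∫⁻ z : ℝ, ∫⁻ r in Ioi (0:ℝ), ∫⁻ θ in Ioo (-Real.pi) Real.pi,
      ENNReal.ofReal r * F (cyl r θ z) = ∫⁻ x, F x := by
  rw [← mp_e3.lintegral_comp hF, Measure.volume_eq_prod, lintegral_prod]
  · congr 1
    ext z
    rw [← lintegral_comp_polarCoord_symm]
    rw [polarCoord_target, Measure.volume_eq_prod, ← Measure.prod_restrict, lintegral_prod]
    · rfl
    · apply Measurable.aemeasurable
      simp only [polarCoord_symm_apply, smul_eq_mul]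
      refine Measurable.mul (by fun_prop) (hF.comp ?_)
      refine (mp_e3.measurable).comp (g := fun p : ℝ × (ℝ × ℝ) =>
        (WithLp.toLp 2 ![p.2.1, p.2.2, p.1] : E3)) (f := fun p : ℝ × ℝ => (z, (p.1 * Real.cos p.2, p.1 * Real.sin p.2))) ?_
      fun_prop
  · exact (hF.comp mp_e3.measurable).aemeasurable

lemma meas_Ω : MeasurableSet Ω := by
  apply IsOpen.measurableSet
  unfold Ω
  apply isOpen_lt <;> fun_prop

lemma cyl_mem {r : ℝ} (hr : 1 < r) (θ z : ℝ) : cyl r θ z ∈ Ω := by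
  have := Real.sin_sq_add_cos_sq θ
  simp only [Ω, cyl, mem_ofPred_eq]
  simp
  have e : (r * Real.cos θ) ^ 2 + (r * Real.sin θ) ^ 2 = r ^ 2 := by linear_combination r ^ 2 * this
  rw [e]; nlinarith

lemma cont_cyl : Continuous (fun p : ℝ × ℝ × ℝ => cyl p.1 p.2.1 p.2.2) := by
  unfold cyl
  apply (PiLp.continuous_toLp 2 (fun _ : Fin 3 => ℝ)).comp
  refine continuous_pi fun i => ?_
  fin_cases i <;> simp <;> fun_prop

lemma lintegral_cyl_Ω (F : E3 → ENNReal) (hF : Measurable F) :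
    ∫⁻ z : ℝ, ∫⁻ r in Ioi (1:ℝ), ∫⁻ θ in Ioo (-Real.pi) Real.pi,
      ENNReal.ofReal r * F (cyl r θ z) ≤ ∫⁻ x in Ω, F x := by
  rw [← lintegral_indicator meas_Ω, ← lintegral_cyl _ (hF.indicator meas_Ω)]
  refine lintegral_mono fun z => ?_
  refine le_trans ?_ (lintegral_mono_set (Ioi_subset_Ioi zero_le_one))
  refine setLIntegral_mono' measurableSet_Ioi fun r hr => ?_
  refine lintegral_mono fun θ => ?_
  simp [indicator_of_mem (cyl_mem hr θ z)]

lemma lintegral_sector (F : E3 → ENNReal) (hF : Measurable F) {r0 : ℝ} (h0 : 1 < r0) (z0 : ℝ) :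
    ∫⁻ a in Ioi (0:ℝ), ∫⁻ m in Ioo (0:ℝ) 1, ∫⁻ θ in Ioo (-Real.pi) Real.pi,
      ENNReal.ofReal (a * (r0 + a)) * F (cyl (r0 + a) θ (z0 + a * m)) ≤ ∫⁻ x in Ω, F x := by
  refine le_trans ?_ (lintegral_cyl_Ω F hF)
  conv_rhs => rw [lintegral_lintegral_swap (by
    have hm : Measurable (fun q : (ℝ × ℝ) × ℝ => ENNReal.ofReal q.1.2 * F (cyl q.1.2 q.2 q.1.1)) := by
      refine Measurable.mul (by fun_prop) (hF.comp ?_)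
      exact cont_cyl.measurable.comp (f := fun q : (ℝ × ℝ) × ℝ => (q.1.2, q.2, q.1.1)) (by fun_prop)
    exact hm.lintegral_prod_right'.aemeasurable)]
  have h1 : (fun a : ℝ => r0 + a) '' Ioi 0 ⊆ Ioi 1 := by
    rintro _ ⟨a, ha, rfl⟩
    simp at ha ⊢; linarith
  refine le_trans ?_ (lintegral_mono_set h1)
  rw [lintegral_image_eq_lintegral_deriv_mul_of_monotoneOn (f := fun a : ℝ => r0 + a) (f' := fun _ => 1) measurableSet_Ioi
    (fun x _ => ((hasDerivAt_id x).const_add r0).hasDerivWithinAt)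
    (fun x _ y _ h => by simpa using h)]
  refine setLIntegral_mono' measurableSet_Ioi fun a ha => ?_
  have ha' : (0:ℝ) < a := ha
  simp only [ENNReal.ofReal_one, one_mul]
  refine le_trans ?_ (setLIntegral_le_lintegral ((fun m : ℝ => z0 + a * m) '' Ioo 0 1) _)
  rw [lintegral_image_eq_lintegral_deriv_mul_of_monotoneOn (f' := fun _ => a) measurableSet_Ioo
    (fun x _ => by
      have := (((hasDerivAt_id x).const_mul a).const_add z0).hasDerivWithinAt (s := Ioo 0 1)
      simpa using this)
    (fun x _ y _ h => by nlinarith)]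
  refine lintegral_mono fun m => ?_
  rw [← lintegral_const_mul' _ _ ENNReal.ofReal_ne_top]
  refine lintegral_mono fun θ => ?_
  rw [← mul_assoc, ENNReal.ofReal_mul ha'.le]

lemma frob_bound (v : E3 → E3) (x w : E3) :
    ‖fderiv ℝ v x w‖ ≤ Real.sqrt (frobSq v x) * ‖w‖ := by
  have hw : w = ∑ i : Fin 3, w i • (EuclideanSpace.single i (1:ℝ) : E3) := by
    ext j
    fin_cases j <;> simp [Fin.sum_univ_three]
  have h1 : ‖fderiv ℝ v x w‖ ≤ ∑ i : Fin 3, |w i| * ‖fderiv ℝ v x (EuclideanSpace.single i 1)‖ := by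
    conv_lhs => rw [hw, map_sum]
    refine (norm_sum_le _ _).trans (Finset.sum_le_sum fun i _ => ?_)
    rw [map_smul, norm_smul, Real.norm_eq_abs]
  refine h1.trans ((Real.sum_mul_le_sqrt_mul_sqrt _ _ _).trans ?_)
  rw [mul_comm, EuclideanSpace.norm_eq]
  simp [frobSq]

lemma line_bound (v : E3 → E3) (hv : ContDiff ℝ 1 v) (hc : HasCompactSupport v) (x w : E3)
    (hw : w ≠ 0) :
    ‖v x‖ₑ ≤ ∫⁻ a in Ioi (0:ℝ), ‖fderiv ℝ v (x + a • w) w‖ₑ := by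
  obtain ⟨R, hR⟩ := hc.isBounded.subset_closedBall (0:E3)
  have hw' : 0 < ‖w‖ := norm_pos_iff.mpr hw
  set A : ℝ := (|R| + ‖x‖ + 1) / ‖w‖ with hA
  have hA0 : 0 < A := by positivity
  have hz : v (x + A • w) = 0 := by
    apply image_eq_zero_of_notMem_tsupport
    intro h
    have h2 := hR h
    rw [mem_closedBall_zero_iff] at h2
    have h3 : ‖A • w‖ = |R| + ‖x‖ + 1 := by
      rw [norm_smul, Real.norm_of_nonneg hA0.le, hA]; field_simp
    have h4 := norm_sub_norm_le (A • w) (-x)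
    rw [sub_neg_eq_add, add_comm (A • w), norm_neg] at h4
    have := le_abs_self R
    linarith
  have hd : ∀ a : ℝ, HasDerivAt (fun a : ℝ => v (x + a • w)) (fderiv ℝ v (x + a • w) w) a := by
    intro a
    have h1 : HasDerivAt (fun a : ℝ => x + a • w) w a := by
      simpa using ((hasDerivAt_id a).smul_const w).const_add x
    exact ((hv.differentiable one_ne_zero) _).hasFDerivAt.comp_hasDerivAt a h1
  have h := enorm_sub_le_lintegral_deriv_of_contDiffOn_Icc (f := fun a : ℝ => v (x + a • w))
    (a := 0) (b := A) (ContDiff.contDiffOn (by fun_prop)) hA0.le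
  simp only [hz, zero_smul, add_zero, zero_sub, enorm_neg] at h
  refine h.trans ?_
  rw [← restrict_Ioo_eq_restrict_Icc]
  refine le_trans ?_ (lintegral_mono_set (s := Ioo 0 A) Ioo_subset_Ioi_self)
  exact lintegral_mono fun a => by rw [(hd a).deriv]

lemma cont_frob (v : E3 → E3) (hv : ContDiff ℝ 1 v) : Continuous (frobSq v) := by
  have := hv.continuous_fderiv one_ne_zero
  unfold frobSq
  fun_prop

lemma frob_nonneg (v : E3 → E3) (x : E3) : 0 ≤ frobSq v x := by
  unfold frobSq; positivity

def Hf (v : E3 → E3) (r0 z0 : ℝ) (p : ℝ × ℝ × ℝ) : ENNReal :=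
  ENNReal.ofReal (Real.sqrt (frobSq v (cyl (r0 + p.1) p.2.2 (z0 + p.1 * p.2.1))))

lemma meas_Hf (v : E3 → E3) (hv : ContDiff ℝ 1 v) (r0 z0 : ℝ) : Measurable (Hf v r0 z0) := by
  unfold Hf
  have h := cont_cyl.comp (f := fun p : ℝ × ℝ × ℝ => (r0 + p.1, p.2.2, z0 + p.1 * p.2.1)) (by fun_prop)
  have h2 := ((cont_frob v hv).comp h).sqrt
  exact h2.measurable.ennreal_ofReal

def νf : Measure (ℝ × ℝ) :=
  (volume.restrict (Ioo (0:ℝ) 1)).prod (volume.restrict (Ioo (-Real.pi) Real.pi))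

instance : SFinite νf := by unfold νf; infer_instance

lemma νf_univ : νf univ = ENNReal.ofReal (2 * Real.pi) := by
  unfold νf
  rw [← univ_prod_univ, Measure.prod_prod]
  simp only [Measure.restrict_apply_univ, Real.volume_Ioo]
  rw [← ENNReal.ofReal_mul (by norm_num)]
  congr 1; ring

lemma avg_bound (v : E3 → E3) (hv : ContDiff ℝ 1 v) (hc : HasCompactSupport v) (r0 z0 : ℝ)
    (N : ENNReal) (hN : ∀ θ, ‖v (cyl r0 θ z0)‖ₑ = N) :
    ENNReal.ofReal (2 * Real.pi) * N ≤
      2 * ∫⁻ p, Hf v r0 z0 p ∂((volume.restrict (Ioi (0:ℝ))).prod νf) := by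
  rw [lintegral_prod_symm _ (meas_Hf v hv r0 z0).aemeasurable, ← νf_univ, mul_comm, ← lintegral_const,
    ← lintegral_const_mul' _ _ (by simp)]
  have hae : ∀ᵐ y ∂νf, y.1 ∈ Ioo (0:ℝ) 1 := by
    unfold νf
    rw [Measure.prod_restrict]
    filter_upwards [ae_restrict_mem (measurableSet_Ioo.prod measurableSet_Ioo)] with y hy using hy.1
  refine lintegral_mono_ae ?_
  filter_upwards [hae] with y hy
  rw [← hN y.2]
  set w : E3 := cyl 1 y.2 y.1 with hw
  have hwn : ‖w‖ ≤ 2 := by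
    rw [hw, EuclideanSpace.norm_eq]
    apply Real.sqrt_le_iff.mpr
    have := Real.sin_sq_add_cos_sq y.2
    simp [cyl, Fin.sum_univ_three]
    nlinarith [hy.1, hy.2]
  have hw0 : w ≠ 0 := by
    intro h
    have h0 : w 0 = 0 := by rw [h]; rfl
    have h1 : w 1 = 0 := by rw [h]; rfl
    have := Real.sin_sq_add_cos_sq y.2
    simp [hw, cyl] at h0 h1
    rw [h0, h1] at this
    norm_num at this
  refine (line_bound v hv hc _ w hw0).trans ?_
  rw [← lintegral_const_mul' _ _ (by simp)]
  refine lintegral_mono fun a => ?_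
  have hx : cyl r0 y.2 z0 + a • w = cyl (r0 + a) y.2 (z0 + a * y.1) := by
    ext i
    fin_cases i <;> simp [hw, cyl] <;> ring
  rw [hx, Hf, ← ofReal_norm]
  have h2 : (2 : ENNReal) = ENNReal.ofReal 2 := by simp
  refine le_of_le_of_eq ?_ (congrArg (fun t : ENNReal => t * ENNReal.ofReal _) h2.symm)
  simp only
  rw [← ENNReal.ofReal_mul (by norm_num)]
  apply ENNReal.ofReal_le_ofReal
  refine (frob_bound v _ w).trans ?_
  rw [mul_comm]
  gcongr

lemma holder_w {Y : Type*} [MeasurableSpace Y] (ν : Measure Y) [SFinite ν] (S : Set ℝ)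
    (hS : MeasurableSet S) (w : ℝ → ℝ) (hw : Measurable w) (hw0 : ∀ a ∈ S, 0 < w a)
    (H : ℝ × Y → ENNReal) (hH : Measurable H) {p q : ℝ} (hpq : p.HolderConjugate q) :
    ∫⁻ x, H x ∂((volume.restrict S).prod ν) ≤
      (∫⁻ x, ENNReal.ofReal (w x.1) * H x ^ p ∂((volume.restrict S).prod ν)) ^ (1 / p) *
      (ν univ * ∫⁻ a in S, ENNReal.ofReal (w a ^ (- (q / p)))) ^ (1 / q) := by
  have hp := hpq.pos
  have hq := hpq.symm.pos
  have hae : ∀ᵐ x ∂((volume.restrict S).prod ν), x.1 ∈ S :=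
    Measure.quasiMeasurePreserving_fst.ae (ae_restrict_mem hS)
  set f : ℝ × Y → ENNReal := fun x => H x * ENNReal.ofReal (w x.1 ^ (1 / p)) with hf
  set g : ℝ × Y → ENNReal := fun x => ENNReal.ofReal (w x.1 ^ (- (1 / p))) with hg
  have hfm : Measurable f := by fun_prop
  have hgm : Measurable g := by fun_prop
  have key := ENNReal.lintegral_mul_le_Lp_mul_Lq ((volume.restrict S).prod ν) hpq
    hfm.aemeasurable hgm.aemeasurable
  have e1 : ∫⁻ x, H x ∂((volume.restrict S).prod ν) = ∫⁻ x, (f * g) x ∂((volume.restrict S).prod ν) := by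
    apply lintegral_congr_ae
    filter_upwards [hae] with x hx
    simp only [hf, hg, Pi.mul_apply]
    rw [mul_assoc, ← ENNReal.ofReal_mul (Real.rpow_nonneg (hw0 _ hx).le _),
      ← Real.rpow_add (hw0 _ hx)]
    simp
  have e2 : ∫⁻ x, f x ^ p ∂((volume.restrict S).prod ν) =
      ∫⁻ x, ENNReal.ofReal (w x.1) * H x ^ p ∂((volume.restrict S).prod ν) := by
    apply lintegral_congr_ae
    filter_upwards [hae] with x hx
    simp only [hf]
    rw [ENNReal.mul_rpow_of_nonneg _ _ hp.le, ENNReal.ofReal_rpow_of_nonneg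
      (Real.rpow_nonneg (hw0 _ hx).le _) hp.le, ← Real.rpow_mul (hw0 _ hx).le, mul_comm]
    congr 2
    rw [one_div, inv_mul_cancel₀ hp.ne', Real.rpow_one]
  have e3 : ∫⁻ x, g x ^ q ∂((volume.restrict S).prod ν) =
      ν univ * ∫⁻ a in S, ENNReal.ofReal (w a ^ (- (q / p))) := by
    rw [lintegral_prod_symm _ (by fun_prop)]
    simp only [hg]
    rw [lintegral_const, mul_comm]
    congr 1
    apply setLIntegral_congr_fun hS
    intro a ha
    simp only
    rw [ENNReal.ofReal_rpow_of_nonneg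
      (Real.rpow_nonneg (hw0 _ ha).le _) hq.le, ← Real.rpow_mul (hw0 _ ha).le]
    congr 2
    ring
  rw [e1]
  rw [e2, e3] at key
  exact key

lemma near_int {ρ : ℝ} (hρ : 0 < ρ) :
    ∫⁻ a in Ioc 0 ρ, ENNReal.ofReal (a ^ (-(1/5) : ℝ)) = ENNReal.ofReal (5 / 4 * ρ ^ (4/5 : ℝ)) := by
  have hi : IntervalIntegrable (fun a : ℝ => a ^ (-(1/5) : ℝ)) volume 0 ρ :=
    intervalIntegral.intervalIntegrable_rpow' (by norm_num)
  rw [← ofReal_integral_eq_lintegral_ofReal]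
  · rw [← intervalIntegral.integral_of_le hρ.le, integral_rpow (Or.inl (by norm_num))]
    congr 1
    norm_num
    ring
  · exact (intervalIntegrable_iff_integrableOn_Ioc_of_le hρ.le).mp hi
  · filter_upwards [ae_restrict_mem measurableSet_Ioc] with a ha
    exact Real.rpow_nonneg ha.1.le _

lemma far_int {ρ : ℝ} (hρ : 0 < ρ) :
    ∫⁻ a in Ioi ρ, ENNReal.ofReal (1 / (a * (1 + a))) = ENNReal.ofReal (Real.log (1 + 1 / ρ)) := by
  have hd : ∀ x ∈ Ici ρ, HasDerivAt (fun a : ℝ => - Real.log (1 + a⁻¹)) (1 / (x * (1 + x))) x := by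
    intro x hx
    have hx0 : 0 < x := hρ.trans_le hx
    have h1 : HasDerivAt (fun a : ℝ => 1 + a⁻¹) (-(x^2)⁻¹) x := (hasDerivAt_inv hx0.ne').const_add 1
    have h2 := (h1.log (by positivity)).neg
    convert! h2 using 1
    field_simp
    ring
  have hpos : ∀ x ∈ Ioi ρ, 0 ≤ 1 / (x * (1 + x)) := by
    intro x hx
    have : 0 < x := hρ.trans hx
    positivity
  have ht : Filter.Tendsto (fun a : ℝ => - Real.log (1 + a⁻¹)) Filter.atTop (nhds 0) := by
    have h1 : Filter.Tendsto (fun a : ℝ => 1 + a⁻¹) Filter.atTop (nhds (1 + 0)) :=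
      tendsto_inv_atTop_zero.const_add 1
    have h2 := (h1.log (by norm_num)).neg
    simpa using h2
  rw [← ofReal_integral_eq_lintegral_ofReal (integrableOn_Ioi_deriv_of_nonneg' hd hpos ht)]
  · rw [integral_Ioi_of_hasDerivAt_of_nonneg' hd hpos ht]
    simp
  · filter_upwards [ae_restrict_mem measurableSet_Ioi] with a ha using hpos a ha

lemma weighted_bound (v : E3 → E3) (hv : ContDiff ℝ 1 v) {r0 : ℝ} (h0 : 1 < r0) (z0 : ℝ)
    (S : Set ℝ) (hS : S ⊆ Ioi 0) (k : ℝ) :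
    ∫⁻ p, ENNReal.ofReal (p.1 * (r0 + p.1)) * Hf v r0 z0 p ^ k ∂((volume.restrict S).prod νf) ≤
      ∫⁻ x in Ω, ENNReal.ofReal (Real.sqrt (frobSq v x)) ^ k := by
  have hm := meas_Hf v hv r0 z0
  have hF : Measurable (fun x => ENNReal.ofReal (Real.sqrt (frobSq v x)) ^ k) := by
    have := (cont_frob v hv).sqrt.measurable
    fun_prop
  have hm2 : Measurable (fun p : ℝ × ℝ × ℝ => ENNReal.ofReal (p.1 * (r0 + p.1)) * Hf v r0 z0 p ^ k) := by
    fun_prop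
  refine le_trans ?_ (lintegral_sector _ hF h0 z0)
  rw [lintegral_prod _ hm2.aemeasurable]
  refine (lintegral_mono_set hS).trans ?_
  refine lintegral_mono fun a => ?_
  unfold νf
  exact (lintegral_prod _ (hm2.comp measurable_prodMk_left).aemeasurable).le

lemma point_enn (v : E3 → E3) (hv : ContDiff ℝ 1 v) (hc : HasCompactSupport v) {r0 : ℝ}
    (h0 : 1 < r0) (z0 : ℝ) (N : ENNReal) (hN : ∀ θ, ‖v (cyl r0 θ z0)‖ₑ = N) {ρ : ℝ} (hρ : 0 < ρ) :
    ENNReal.ofReal (2 * Real.pi) * N ≤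
      2 * ((∫⁻ x in Ω, ENNReal.ofReal (Real.sqrt (frobSq v x)) ^ (6:ℝ)) ^ (1 / 6 : ℝ) *
          (ENNReal.ofReal (2 * Real.pi) * ENNReal.ofReal (5 / 4 * ρ ^ (4/5 : ℝ))) ^ (5 / 6 : ℝ) +
        (∫⁻ x in Ω, ENNReal.ofReal (Real.sqrt (frobSq v x)) ^ (2:ℝ)) ^ (1 / 2 : ℝ) *
          (ENNReal.ofReal (2 * Real.pi) * ENNReal.ofReal (Real.log (1 + 1 / ρ))) ^ (1 / 2 : ℝ)) := by
  refine (avg_bound v hv hc r0 z0 N hN).trans ?_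
  refine mul_le_mul_right ?_ 2
  rw [← Ioc_union_Ioi_eq_Ioi hρ.le, Measure.restrict_union (by
    rw [Set.disjoint_left]; intro x hx hx2; exact absurd hx.2 (not_le.mpr hx2)) measurableSet_Ioi,
    Measure.add_prod, lintegral_add_measure]
  have hm := meas_Hf v hv r0 z0
  refine add_le_add ?_ ?_
  · have hpq : (6:ℝ).HolderConjugate (6/5) := by
      rw [Real.holderConjugate_iff]; norm_num
    have := holder_w νf (Ioc 0 ρ) measurableSet_Ioc (fun a => a * (r0 + a)) (by fun_prop)
      (fun a ha => by have := ha.1; positivity) _ hm hpq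
    refine this.trans ?_
    have e : (1 / (6/5) : ℝ) = 5 / 6 := by norm_num
    rw [e]
    gcongr
    · exact weighted_bound v hv h0 z0 _ Ioc_subset_Ioi_self 6
    · exact νf_univ.le
    · rw [← near_int hρ]
      refine setLIntegral_mono' measurableSet_Ioc fun a ha => ?_
      apply ENNReal.ofReal_le_ofReal
      have e2 : (-(6/5/6) : ℝ) = -(1/5) := by norm_num
      rw [e2]
      apply Real.rpow_le_rpow_of_nonpos ha.1 _ (by norm_num)
      nlinarith [ha.1]
  · have hpq : (2:ℝ).HolderConjugate 2 := by
      rw [Real.holderConjugate_iff]; norm_num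
    have := holder_w νf (Ioi ρ) measurableSet_Ioi (fun a => a * (r0 + a)) (by fun_prop)
      (fun a ha => by have := hρ.trans ha; positivity) _ hm hpq
    refine this.trans ?_
    gcongr
    · exact weighted_bound v hv h0 z0 _ (Ioi_subset_Ioi hρ.le) 2
    · exact νf_univ.le
    · rw [← far_int hρ]
      refine setLIntegral_mono' measurableSet_Ioi fun a ha => ?_
      apply ENNReal.ofReal_le_ofReal
      have ha0 : 0 < a := hρ.trans ha
      have e2 : (-(2/2) : ℝ) = -1 := by norm_num
      rw [e2, Real.rpow_neg_one, one_div]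
      gcongr

lemma point_real (v : E3 → E3) (hv : ContDiff ℝ 1 v) (hc : HasCompactSupport v) {r0 : ℝ}
    (h0 : 1 < r0) (z0 : ℝ) (N : ℝ) (hN0 : 0 ≤ N) (hN : ∀ θ, ‖v (cyl r0 θ z0)‖ = N)
    {ρ : ℝ} (hρ : 0 < ρ) (hρ1 : ρ ≤ 1) (S D : ℝ) (hS : 0 ≤ S) (hD : 0 ≤ D)
    (h6 : (∫⁻ x in Ω, ENNReal.ofReal (Real.sqrt (frobSq v x)) ^ (6:ℝ)) ^ (1 / 6 : ℝ) = ENNReal.ofReal S)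
    (h2 : (∫⁻ x in Ω, ENNReal.ofReal (Real.sqrt (frobSq v x)) ^ (2:ℝ)) ^ (1 / 2 : ℝ)
      = ENNReal.ofReal (Real.sqrt D)) :
    N ^ 2 ≤ 13 * ρ * S ^ 2 + 8 * (D * Real.log (1 + 1 / ρ)) := by
  have h := point_enn v hv hc h0 z0 (ENNReal.ofReal N)
    (fun θ => by rw [← ofReal_norm, hN θ]) hρ
  have hpi := Real.pi_gt_three
  have hL : 0 ≤ Real.log (1 + 1 / ρ) := Real.log_nonneg (by
    have : 0 < 1 / ρ := by positivity
    linarith)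
  set L := Real.log (1 + 1 / ρ) with hLdef
  have h22 : (2 : ENNReal) = ENNReal.ofReal 2 := by simp
  rw [h6, h2, ← ENNReal.ofReal_mul (by positivity), ← ENNReal.ofReal_mul (by positivity),
    ← ENNReal.ofReal_mul (by positivity), ENNReal.ofReal_rpow_of_nonneg (by positivity) (by norm_num),
    ENNReal.ofReal_rpow_of_nonneg (by positivity) (by norm_num),
    ← ENNReal.ofReal_mul (by positivity), ← ENNReal.ofReal_mul (by positivity),
    ← ENNReal.ofReal_add (by positivity) (by positivity), h22, ← ENNReal.ofReal_mul (by positivity),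
    ENNReal.ofReal_le_ofReal_iff (by positivity)] at h
  have e1 : (2 * Real.pi * (5 / 4 * ρ ^ (4/5 : ℝ))) ^ (5/6 : ℝ) ≤ 5 / 2 * Real.pi * Real.sqrt ρ := by
    have e : 2 * Real.pi * (5 / 4 * ρ ^ (4/5 : ℝ)) = (5 / 2 * Real.pi) * ρ ^ (4/5 : ℝ) := by ring
    rw [e, Real.mul_rpow (by positivity) (by positivity), ← Real.rpow_mul hρ.le, Real.sqrt_eq_rpow]
    gcongr ?_ * ?_
    · calc (5 / 2 * Real.pi) ^ (5/6 : ℝ) ≤ (5 / 2 * Real.pi) ^ (1 : ℝ) :=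
          Real.rpow_le_rpow_of_exponent_le (by linarith) (by norm_num)
        _ = _ := Real.rpow_one _
    · exact Real.rpow_le_rpow_of_exponent_ge hρ hρ1 (by norm_num)
  have e2 : (2 * Real.pi * L) ^ (1/2 : ℝ) ≤ 2 * Real.pi * Real.sqrt L := by
    rw [← Real.sqrt_eq_rpow, Real.sqrt_mul (by positivity)]
    gcongr
    rw [Real.sqrt_le_left (by positivity)]
    nlinarith
  have h3 : 2 * Real.pi * N ≤ 2 * (S * (5 / 2 * Real.pi * Real.sqrt ρ) +
      Real.sqrt D * (2 * Real.pi * Real.sqrt L)) := by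
    refine h.trans ?_
    gcongr
  have h4 : N ≤ 5 / 2 * (S * Real.sqrt ρ) + 2 * (Real.sqrt D * Real.sqrt L) := by
    have : 2 * Real.pi * N ≤ 2 * Real.pi * (5 / 2 * (S * Real.sqrt ρ) + 2 * (Real.sqrt D * Real.sqrt L)) := by
      linarith
    exact le_of_mul_le_mul_left this (by positivity)
  have q1 := Real.sq_sqrt hρ.le
  have q2 := Real.sq_sqrt hD
  have q3 := Real.sq_sqrt hL
  set A := S * Real.sqrt ρ
  set B := Real.sqrt D * Real.sqrt L
  have hA : A ^ 2 = S ^ 2 * ρ := by rw [mul_pow, q1]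
  have hB : B ^ 2 = D * L := by rw [mul_pow, q2, q3]
  have hA0 : 0 ≤ A := by positivity
  have hB0 : 0 ≤ B := by positivity
  have : N ^ 2 ≤ (5 / 2 * A + 2 * B) ^ 2 := by gcongr
  nlinarith [sq_nonneg (5 / 2 * A - 2 * B), sq_nonneg A]

lemma open_Ω : IsOpen Ω := by
  unfold Ω
  apply isOpen_lt <;> fun_prop

lemma exists_cyl (x : E3) (hx : x ∈ Ω) : ∃ r θ z, 1 < r ∧ x = cyl r θ z := by
  set c : ℂ := ⟨x 0, x 1⟩ with hc
  refine ⟨‖c‖, c.arg, x 2, ?_, ?_⟩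
  · have h : 1 < x 0 ^ 2 + x 1 ^ 2 := hx
    have h2 : ‖c‖ ^ 2 = x 0 ^ 2 + x 1 ^ 2 := by
      rw [Complex.sq_norm, Complex.normSq_apply]; simp [hc]; ring
    nlinarith [norm_nonneg c]
  · ext i
    fin_cases i <;> simp [cyl, Complex.norm_mul_cos_arg, Complex.norm_mul_sin_arg, hc]

lemma norm_axi (a b c θ : ℝ) :
    ‖a • erv θ + b • eθv θ + c • ezv‖ = Real.sqrt (a ^ 2 + b ^ 2 + c ^ 2) := by
  rw [EuclideanSpace.norm_eq]
  congr 1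
  have := Real.sin_sq_add_cos_sq θ
  simp [Fin.sum_univ_three, erv, eθv, ezv]
  linear_combination (a ^ 2 + b ^ 2) * this

lemma frob_support (v : E3 → E3) (K : Set E3) (hK : IsCompact K) (h : ∀ x, x ∉ K → v x = 0)
    (x : E3) (hx : x ∉ K) : frobSq v x = 0 := by
  have : v =ᶠ[nhds x] fun _ => 0 := by
    filter_upwards [hK.isClosed.isOpen_compl.mem_nhds hx] with y hy using h y hy
  unfold frobSq
  rw [this.fderiv_eq]
  simp

lemma memLp_frob (v : E3 → E3) (hv : ContDiff ℝ 1 v) (K : Set E3) (hK : IsCompact K)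
    (h : ∀ x, x ∉ K → v x = 0) :
    MemLp (fun x => Real.sqrt (frobSq v x)) 6 (volume.restrict Ω) := by
  apply Continuous.memLp_of_hasCompactSupport
  · exact (cont_frob v hv).sqrt
  · exact HasCompactSupport.intro hK fun x hx => by rw [frob_support v K hK h x hx, Real.sqrt_zero]

lemma slice_sup (v : E3 → E3) (hv : ContDiff ℝ 1 v) (K : Set E3) (hK : IsCompact K)
    (h : ∀ x, x ∉ K → v x = 0)
    (hax : ∃ ur uθ uz : ℝ → ℝ → ℝ, ∀ r θ z : ℝ, 1 < r →
      v (cyl r θ z) = ur r z • erv θ + uθ r z • eθv θ + uz r z • ezv)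
    {ρ : ℝ} (hρ : 0 < ρ) (hρ1 : ρ ≤ 1) :
    ((eLpNorm v ⊤ (volume.restrict Ω)).toReal) ^ 2 ≤
      13 * ρ * (eLpNorm (fun x => Real.sqrt (frobSq v x)) 6 (volume.restrict Ω)).toReal ^ 2 +
        8 * ((∫ x in Ω, frobSq v x) * Real.log (1 + 1 / ρ)) := by
  obtain ⟨ur, uθ, uz, hax⟩ := hax
  have hc : HasCompactSupport v := HasCompactSupport.intro hK h
  have hmem := memLp_frob v hv K hK h
  set S := (eLpNorm (fun x => Real.sqrt (frobSq v x)) 6 (volume.restrict Ω)).toReal with hS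
  set D := ∫ x in Ω, frobSq v x with hD
  have hD0 : 0 ≤ D := integral_nonneg fun x => frob_nonneg v x
  have h6 : (∫⁻ x in Ω, ENNReal.ofReal (Real.sqrt (frobSq v x)) ^ (6:ℝ)) ^ (1 / 6 : ℝ)
      = ENNReal.ofReal S := by
    rw [hS, ENNReal.ofReal_toReal hmem.2.ne,
      eLpNorm_eq_lintegral_rpow_enorm_toReal (by norm_num) (by norm_num)]
    simp only [ENNReal.toReal_ofNat]
    congr 2
    ext x
    rw [Real.enorm_of_nonneg (Real.sqrt_nonneg _)]
  have h2 : (∫⁻ x in Ω, ENNReal.ofReal (Real.sqrt (frobSq v x)) ^ (2:ℝ)) ^ (1 / 2 : ℝ)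
      = ENNReal.ofReal (Real.sqrt D) := by
    have hint : Integrable (frobSq v) (volume.restrict Ω) :=
      ((cont_frob v hv).integrable_of_hasCompactSupport
        (HasCompactSupport.intro hK (frob_support v K hK h))).restrict
    have : ∫⁻ x in Ω, ENNReal.ofReal (Real.sqrt (frobSq v x)) ^ (2:ℝ) = ENNReal.ofReal D := by
      rw [hD, ofReal_integral_eq_lintegral_ofReal hint
        (Filter.Eventually.of_forall fun x => frob_nonneg v x)]
      congr 1
      ext x
      rw [ENNReal.ofReal_rpow_of_nonneg (Real.sqrt_nonneg _) (by norm_num), Real.rpow_two,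
        Real.sq_sqrt (frob_nonneg v x)]
    rw [this, ENNReal.ofReal_rpow_of_nonneg hD0 (by norm_num), Real.sqrt_eq_rpow]
  set Q := 13 * ρ * S ^ 2 + 8 * (D * Real.log (1 + 1 / ρ)) with hQ
  have hb : ∀ x ∈ Ω, ‖v x‖ ≤ Real.sqrt Q := by
    intro x hx
    obtain ⟨r, θ, z, hr, rfl⟩ := exists_cyl x hx
    apply Real.le_sqrt_of_sq_le
    refine point_real v hv hc hr z _ (norm_nonneg _) ?_ hρ hρ1 S D ENNReal.toReal_nonneg hD0 h6 h2
    intro θ'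
    rw [hax r θ' z hr, hax r θ z hr, norm_axi, norm_axi]
  have hQ0 : 0 ≤ Q := by
    have : 0 ≤ Real.log (1 + 1 / ρ) := Real.log_nonneg (by
      have : 0 < 1 / ρ := by positivity
      linarith)
    positivity
  have h3 : eLpNorm v ⊤ (volume.restrict Ω) ≤ ENNReal.ofReal (Real.sqrt Q) := by
    rw [eLpNorm_exponent_top]
    apply eLpNormEssSup_le_of_ae_bound
    filter_upwards [ae_restrict_mem meas_Ω] with x hx using hb x hx
  have h4 := ENNReal.toReal_le_of_le_ofReal (Real.sqrt_nonneg _) h3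
  calc _ ≤ Real.sqrt Q ^ 2 := by gcongr
    _ = Q := Real.sq_sqrt hQ0

lemma slice_smooth {s T : ℝ} (u : E3 → ℝ → E3)
    (hu : ContDiffOn ℝ (⊤ : ℕ∞) (fun p : E3 × ℝ => u p.1 p.2) (Ω ×ˢ Set.Icc s T))
    (K : Set E3) (hK : IsCompact K) (hKΩ : K ⊆ Ω)
    (h : ∀ t ∈ Set.Icc s T, ∀ x, x ∉ K → u x t = 0) (t : ℝ) (ht : t ∈ Icc s T) :
    ContDiff ℝ 1 (fun x => u x t) := by
  rw [contDiff_iff_contDiffAt]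
  intro x
  by_cases hx : x ∈ Ω
  · have h1 : ContDiffOn ℝ 1 (fun x => u x t) Ω := by
      have := (hu.of_le (m := 1) (by exact_mod_cast le_top)).comp (f := fun x : E3 => (x, t)) (s := Ω)
        (ContDiff.contDiffOn (by fun_prop)) (fun y hy => ⟨hy, ht⟩)
      exact this
    exact h1.contDiffAt (open_Ω.mem_nhds hx)
  · have : (fun x => u x t) =ᶠ[nhds x] fun _ => 0 := by
      filter_upwards [hK.isClosed.isOpen_compl.mem_nhds (fun hk => hx (hKΩ hk))] with y hy
        using h t ht y hy
    exact contDiffAt_const.congr_of_eventuallyEq this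

lemma cont_ext {s T : ℝ} (F : ℝ → E3 → ℝ) (K : Set E3) (hK : IsCompact K) (hKΩ : K ⊆ Ω)
    (hF : ContinuousOn (fun p : E3 × ℝ => F p.2 p.1) (Ω ×ˢ Icc s T))
    (h : ∀ t x, t ∈ Icc s T → x ∉ K → F t x = 0) :
    ContinuousOn (Function.uncurry F) (Icc s T ×ˢ univ) := by
  rintro ⟨t, x⟩ ⟨ht, -⟩
  by_cases hx : x ∈ Ω
  · have h1 : ContinuousOn (Function.uncurry F) (Icc s T ×ˢ Ω) :=
      hF.comp (f := Prod.swap) continuous_swap.continuousOn (fun p hp => ⟨hp.2, hp.1⟩)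
    refine (h1 (t, x) ⟨ht, hx⟩).mono_of_mem_nhdsWithin ?_
    rw [mem_nhdsWithin]
    exact ⟨univ ×ˢ Ω, isOpen_univ.prod open_Ω, ⟨mem_univ _, hx⟩, fun p hp => ⟨hp.2.1, hp.1.2⟩⟩
  · have hxK : x ∉ K := fun hk => hx (hKΩ hk)
    refine (continuousWithinAt_const (b := (0:ℝ))).congr_of_eventuallyEq ?_ (h t x ht hxK)
    rw [Filter.EventuallyEq, eventually_nhdsWithin_iff]
    filter_upwards [(isOpen_univ.prod hK.isClosed.isOpen_compl).mem_nhds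
      (show (t, x) ∈ univ ×ˢ Kᶜ from ⟨mem_univ _, hxK⟩)] with p hp hp2
    exact h p.1 p.2 hp2.1 hp.2

lemma cont_frob_joint {s T : ℝ} (hsT : s < T) (u : E3 → ℝ → E3)
    (hu : ContDiffOn ℝ (⊤ : ℕ∞) (fun p : E3 × ℝ => u p.1 p.2) (Ω ×ˢ Set.Icc s T)) :
    ContinuousOn (fun p : E3 × ℝ => frobSq (fun y => u y p.2) p.1) (Ω ×ˢ Icc s T) := by
  have hun : UniqueDiffOn ℝ (Ω ×ˢ Icc s T) := open_Ω.uniqueDiffOn.prod (uniqueDiffOn_Icc hsT)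
  have hu1 : ContDiffOn ℝ 1 (fun p : E3 × ℝ => u p.1 p.2) (Ω ×ˢ Set.Icc s T) :=
    hu.of_le (m := 1) (by exact_mod_cast le_top)
  have hc := hu1.continuousOn_fderivWithin hun le_rfl
  have he : ∀ p ∈ Ω ×ˢ Icc s T, ∀ w : E3, fderiv ℝ (fun y => u y p.2) p.1 w =
      fderivWithin ℝ (fun p : E3 × ℝ => u p.1 p.2) (Ω ×ˢ Icc s T) p (w, 0) := by
    intro p hp w
    have h1 := ((hu1.differentiableOn one_ne_zero) p hp).hasFDerivWithinAt
    have h2 : HasFDerivWithinAt (fun y : E3 => (y, p.2)) (ContinuousLinearMap.inl ℝ E3 ℝ) Ω p.1 :=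
      (hasFDerivAt_prodMk_left p.1 p.2).hasFDerivWithinAt
    have h3 := HasFDerivWithinAt.comp (g := fun p : E3 × ℝ => u p.1 p.2) p.1 (t := Ω ×ˢ Icc s T) h1 h2
      (fun y hy => ⟨hy, hp.2⟩)
    have h4 := (h3.hasFDerivAt (open_Ω.mem_nhds hp.1)).fderiv
    have h5 : fderiv ℝ (fun y => u y p.2) p.1 = _ := h4
    rw [h5]
    rfl
  have h6 : ContinuousOn (fun p : E3 × ℝ => ∑ i : Fin 3, ‖fderivWithin ℝ (fun p : E3 × ℝ => u p.1 p.2)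
      (Ω ×ˢ Icc s T) p (EuclideanSpace.single i 1, 0)‖ ^ 2) (Ω ×ˢ Icc s T) := by
    fun_prop
  refine h6.congr fun p hp => ?_
  simp only [frobSq]
  refine Finset.sum_congr rfl fun i _ => ?_
  rw [he p hp]

lemma L6_cont {E : Type*} [NormedAddCommGroup E] {s T : ℝ} (f : ℝ → E3 → E) (K : Set E3) (hK : IsCompact K)
    (hKΩ : K ⊆ Ω)
    (hF : ContinuousOn (fun p : E3 × ℝ => ‖f p.2 p.1‖) (Ω ×ˢ Icc s T))
    (h : ∀ t x, t ∈ Icc s T → x ∉ K → f t x = 0)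
    (hm : ∀ t ∈ Icc s T, MemLp (f t) 6 (volume.restrict Ω)) :
    ContinuousOn (fun t => (eLpNorm (f t) 6 (volume.restrict Ω)).toReal) (Icc s T) := by
  have h1 : ContinuousOn (fun t => ∫ x in Ω, ‖f t x‖ ^ (6:ℝ)) (Icc s T) := by
    apply continuousOn_integral_of_compact_support hK
    · exact cont_ext (fun t x => ‖f t x‖ ^ (6:ℝ)) K hK hKΩ
        (hF.rpow_const fun _ _ => Or.inr (by norm_num)) (fun t x ht hx => by simp [h t x ht hx])
    · intro t x ht hx
      simp [h t x ht hx]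
  refine (h1.rpow_const (p := (6:ℝ)⁻¹) fun _ _ => Or.inr (by norm_num)).congr fun t ht => ?_
  have := (hm t ht).eLpNorm_eq_integral_rpow_norm (by norm_num) (by norm_num)
  simp only [this, ENNReal.toReal_ofNat]
  rw [ENNReal.toReal_ofReal]
  exact Real.rpow_nonneg (integral_nonneg fun x => by positivity) _

/-- **Estimate (3.16) of the paper (Lemma 3.2)**: the key logarithmic bound for
`‖u‖_{L²(s,T;L^∞(Ω))}` for smooth axisymmetric vector fields on the exterior of the unit
cylinder, compactly supported in space:
`∫_s^T ‖u(t)‖_{L^∞(Ω)}² dt ≤ C (∫_s^T ∫_Ω |∇u|²) ·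
  ln(e + (∫_s^T (‖u(t)‖_{L⁶(Ω)} + ‖∇u(t)‖_{L⁶(Ω)})² dt)^{1/2}) + C`. -/
theorem axisymmetric_log_Linfty_bound :
    ∃ C > 0, ∀ s T : ℝ, s < T →
      ∀ u : E3 → ℝ → E3,
        ContDiffOn ℝ (⊤ : ℕ∞) (fun p : E3 × ℝ => u p.1 p.2) (Ω ×ˢ Set.Icc s T) →
        (∃ K : Set E3, IsCompact K ∧ K ⊆ Ω ∧
          ∀ t ∈ Set.Icc s T, ∀ x, x ∉ K → u x t = 0) →
        (∃ ur uθ uz : ℝ → ℝ → ℝ → ℝ, ∀ t ∈ Set.Icc s T, ∀ r θ z : ℝ, 1 < r →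
          u (cyl r θ z) t = ur r z t • erv θ + uθ r z t • eθv θ + uz r z t • ezv) →
        (∫ t in s..T, ((eLpNorm (fun x => u x t) ⊤ (volume.restrict Ω)).toReal) ^ 2)
          ≤ C * (∫ t in s..T, ∫ x in Ω, frobSq (fun y => u y t) x)
              * Real.log (Real.exp 1 + Real.sqrt (∫ t in s..T,
                  ((eLpNorm (fun x => u x t) 6 (volume.restrict Ω)).toReal
                    + (eLpNorm (fun x => Real.sqrt (frobSq (fun y => u y t) x)) 6
                        (volume.restrict Ω)).toReal) ^ 2))
            + C := by
  refine ⟨24, by norm_num, ?_⟩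
  rintro s T hsT u hu ⟨K, hK, hKΩ, hsupp⟩ ⟨ur, uθ, uz, hax⟩
  have hsm := slice_smooth u hu K hK hKΩ hsupp
  have hfr0 : ∀ t x, t ∈ Icc s T → x ∉ K → frobSq (fun y => u y t) x = 0 :=
    fun t x ht hx => frob_support _ K hK (hsupp t ht) x hx
  have hcj := cont_frob_joint hsT u hu
  have cD : ContinuousOn (fun t => ∫ x in Ω, frobSq (fun y => u y t) x) (Icc s T) :=
    continuousOn_integral_of_compact_support hK
      (cont_ext (fun t x => frobSq (fun y => u y t) x) K hK hKΩ hcj hfr0) hfr0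
  have cU : ContinuousOn (fun t => (eLpNorm (fun x => u x t) 6 (volume.restrict Ω)).toReal)
      (Icc s T) :=
    L6_cont (fun t x => u x t) K hK hKΩ hu.continuousOn.norm (fun t x ht hx => hsupp t ht x hx)
      (fun t ht => (hsm t ht).continuous.memLp_of_hasCompactSupport
        (HasCompactSupport.intro hK (hsupp t ht)))
  have cG : ContinuousOn (fun t => (eLpNorm (fun x => Real.sqrt (frobSq (fun y => u y t) x)) 6
      (volume.restrict Ω)).toReal) (Icc s T) :=
    L6_cont (fun t x => Real.sqrt (frobSq (fun y => u y t) x)) K hK hKΩ hcj.sqrt.norm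
      (fun t x ht hx => by rw [hfr0 t x ht hx, Real.sqrt_zero])
      (fun t ht => memLp_frob _ (hsm t ht) K hK (hsupp t ht))
  set dD := fun t => ∫ x in Ω, frobSq (fun y => u y t) x with hdD
  set nU := fun t => (eLpNorm (fun x => u x t) 6 (volume.restrict Ω)).toReal with hnU
  set nG := fun t => (eLpNorm (fun x => Real.sqrt (frobSq (fun y => u y t) x)) 6
      (volume.restrict Ω)).toReal with hnG
  have hU0 : ∀ t, 0 ≤ nU t := fun t => ENNReal.toReal_nonneg
  have hG0 : ∀ t, 0 ≤ nG t := fun t => ENNReal.toReal_nonneg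
  change _ ≤ 24 * (∫ t in s..T, dD t) * Real.log (Real.exp 1 + Real.sqrt (∫ t in s..T,
    (nU t + nG t) ^ 2)) + 24
  have hI0 : 0 ≤ ∫ t in s..T, (nU t + nG t) ^ 2 :=
    intervalIntegral.integral_nonneg hsT.le fun t _ => by positivity
  set N := Real.sqrt (∫ t in s..T, (nU t + nG t) ^ 2) with hN
  have hN0 : 0 ≤ N := Real.sqrt_nonneg _
  have hN2 : N ^ 2 = ∫ t in s..T, (nU t + nG t) ^ 2 := Real.sq_sqrt hI0
  have he := Real.add_one_le_exp (1:ℝ)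
  set X := Real.exp 1 + N with hX
  have hX2 : 2 ≤ X := by linarith
  have hρ : 0 < (X ^ 2)⁻¹ := by positivity
  have hρ1 : (X ^ 2)⁻¹ ≤ 1 := inv_le_one_of_one_le₀ (by nlinarith)
  set ρ := (X ^ 2)⁻¹ with hρd
  have iD : IntervalIntegrable dD volume s T := cD.intervalIntegrable_of_Icc hsT.le
  have iG : IntervalIntegrable (fun t => nG t ^ 2) volume s T :=
    (cG.pow 2).intervalIntegrable_of_Icc hsT.le
  have iUG : IntervalIntegrable (fun t => (nU t + nG t) ^ 2) volume s T :=
    ((cU.add cG).pow 2).intervalIntegrable_of_Icc hsT.le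
  have hG2 : ∫ t in s..T, nG t ^ 2 ≤ N ^ 2 := by
    rw [hN2]
    refine intervalIntegral.integral_mono_on hsT.le iG iUG fun t _ => ?_
    have := hU0 t
    have := hG0 t
    gcongr
    linarith
  have hD0 : 0 ≤ ∫ t in s..T, dD t :=
    intervalIntegral.integral_nonneg hsT.le fun t _ => integral_nonneg fun x => frob_nonneg _ x
  set L := Real.log (1 + 1 / ρ) with hL
  have hL3 : L ≤ 3 * Real.log X := by
    have : (3:ℝ) * Real.log X = Real.log (X ^ 3) := by rw [Real.log_pow]; norm_num
    rw [this, hL, hρd, one_div, inv_inv]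
    apply Real.log_le_log (by positivity)
    nlinarith [sq_nonneg X]
  have main : (∫ t in s..T, ((eLpNorm (fun x => u x t) ⊤ (volume.restrict Ω)).toReal) ^ 2) ≤
      ∫ t in s..T, (13 * ρ * nG t ^ 2 + 8 * L * dD t) := by
    rw [intervalIntegral.integral_of_le hsT.le, intervalIntegral.integral_of_le hsT.le]
    apply integral_mono_of_nonneg
    · exact Filter.Eventually.of_forall fun t => by positivity
    · exact ((iG.const_mul (13 * ρ)).add (iD.const_mul (8 * L))).1
    · filter_upwards [ae_restrict_mem measurableSet_Ioc] with t ht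
      have ht' : t ∈ Icc s T := Ioc_subset_Icc_self ht
      refine (slice_sup (fun x => u x t) (hsm t ht') K hK (hsupp t ht')
        ⟨fun r z => ur r z t, fun r z => uθ r z t, fun r z => uz r z t, hax t ht'⟩ hρ hρ1).trans_eq ?_
      simp only [hdD, hnG, hL]
      ring
  rw [intervalIntegral.integral_add (iG.const_mul (13 * ρ)) (iD.const_mul (8 * L)),
    intervalIntegral.integral_const_mul, intervalIntegral.integral_const_mul] at main
  have hρN : ρ * N ^ 2 ≤ 1 := by
    rw [hρd, inv_mul_le_iff₀ (by positivity), mul_one]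
    have := Real.exp_pos 1
    gcongr
    linarith
  have h1 : 13 * ρ * (∫ t in s..T, nG t ^ 2) ≤ 13 := by
    have : ρ * (∫ t in s..T, nG t ^ 2) ≤ ρ * N ^ 2 := by gcongr
    linarith
  have h2 : 8 * L * (∫ t in s..T, dD t) ≤ 8 * (3 * Real.log X) * (∫ t in s..T, dD t) := by gcongr
  linarith
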